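/- Let ℱ be a separable family of measurable functions f : 𝒳 → ℝ with measurable envelope F, and for α ∈ ℝ let 𝒞_α = {L_f(α) : f ∈ ℱ}. Suppose dim(𝒞_α) < ∞ for every α ∈ ℝ. If X = X₁, X₂, … is a stationary ergodic process with values in (𝒳, 𝒮) whose marginal distribution μ satisfies ∫ F dμ < ∞, then sup_{f ∈ ℱ} | n⁻¹ Σ_{i=1}^n f(X_i) − ∫ f dμ | → 0 almost surely as n → ∞. -/

import Mathlib

open MeasureTheory Set Filter

/-- `𝒞` shatters the finite set `D` if every subset of `D` is cut out by some `C ∈ 𝒞`. -/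
def Shatters {X : Type*} (𝒞 : Set (Set X)) (D : Finset X) : Prop :=
  ∀ B ⊆ D, ∃ C ∈ 𝒞, ∀ x ∈ D, x ∈ C ↔ x ∈ B

/-- `𝒞` has finite VC dimension: the cardinalities of shattered finite sets are bounded. -/
def FiniteVC {X : Type*} (𝒞 : Set (Set X)) : Prop :=
  ∃ k : ℕ, ∀ D : Finset X, Shatters 𝒞 D → D.card ≤ k

/-- `π` is a finite measurable partition of the whole space. -/
def IsFinitePartition {X : Type*} [MeasurableSpace X] (π : Set (Set X)) : Prop :=
  π.Finite ∧ (∀ A ∈ π, MeasurableSet A) ∧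
    (∀ A ∈ π, ∀ B ∈ π, A ≠ B → Disjoint A B) ∧ ⋃₀ π = Set.univ

/-- The `π`-boundary of `C`: union of the cells of `π` meeting both `C` and `Cᶜ`
with positive measure. -/
def piBoundary {X : Type*} [MeasurableSpace X] (μ : Measure X) (π : Set (Set X))
    (C : Set X) : Set X :=
  ⋃₀ {A ∈ π | 0 < μ (A ∩ C) * μ (A ∩ Cᶜ)}

/-- `𝒞` is finitely approximable w.r.t. `μ`: for every `ε > 0` there is a finite measurable
partition `π` such that `μ (∂(C : π)) ≤ ε` for every `C ∈ 𝒞`. -/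
def FinitelyApproximable {X : Type*} [MeasurableSpace X] (μ : Measure X)
    (𝒞 : Set (Set X)) : Prop :=
  ∀ ε : ENNReal, 0 < ε → ∃ π : Set (Set X), IsFinitePartition π ∧
    ∀ C ∈ 𝒞, μ (piBoundary μ π C) ≤ ε

/-- A family `ℱ` of real functions is separable if some countable subfamily `ℱ₀ ⊆ ℱ` is
pointwise dense in `ℱ`. -/
def SeparableFamily {X : Type*} (ℱ : Set (X → ℝ)) : Prop :=
  ∃ ℱ₀ ⊆ ℱ, ℱ₀.Countable ∧ ∀ f ∈ ℱ, ∃ g : ℕ → (X → ℝ), (∀ n, g n ∈ ℱ₀) ∧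
    ∀ x : X, Filter.Tendsto (fun n => g n x) Filter.atTop (nhds (f x))

/-- The running maxima `max (0, S₁ h, …, Sₙ h)` of the Birkhoff sums of `h` along `T`. -/
noncomputable def birkhoffMax {Ω : Type*} (T : Ω → Ω) (h : Ω → ℝ) : ℕ → Ω → ℝ
  | 0, _ => 0
  | n + 1, x => max 0 (h x + birkhoffMax T h n (T x))

section Birkhoff

variable {Ω : Type*} {T : Ω → Ω} {h : Ω → ℝ}

lemma birkhoffMax_nonneg (n : ℕ) (x : Ω) : 0 ≤ birkhoffMax T h n x := by
  cases n with
  | zero => exact le_rfl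
  | succ n => exact le_max_left _ _

lemma birkhoffMax_le_succ (n : ℕ) (x : Ω) :
    birkhoffMax T h n x ≤ birkhoffMax T h (n + 1) x := by
  induction n generalizing x with
  | zero => exact birkhoffMax_nonneg _ _
  | succ n ih => exact max_le_max le_rfl (by linarith [ih (T x)])

lemma monotone_birkhoffMax (x : Ω) : Monotone fun n => birkhoffMax T h n x :=
  monotone_nat_of_le_succ fun n => birkhoffMax_le_succ n x

lemma birkhoffSum_le_birkhoffMax (n : ℕ) (x : Ω) :
    birkhoffSum T h n x ≤ birkhoffMax T h n x := by
  induction n generalizing x with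
  | zero => simp [birkhoffMax]
  | succ n ih =>
    rw [birkhoffSum_succ']
    exact le_max_of_le_right (by linarith [ih (T x)])

lemma birkhoffMax_succ_sub (n : ℕ) (x : Ω) :
    birkhoffMax T h (n + 1) x - birkhoffMax T h n (T x)
      = max (-birkhoffMax T h n (T x)) (h x) := by
  simp only [birkhoffMax, ← max_sub_sub_right]
  congr 1 <;> ring

lemma bddAbove_birkhoffMax_comp (x : Ω) :
    BddAbove (range fun n => birkhoffMax T h n (T x)) ↔
      BddAbove (range fun n => birkhoffMax T h n x) := by
  constructor
  · rintro ⟨B, hB⟩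
    refine ⟨max 0 (h x + B), ?_⟩
    rintro _ ⟨n, rfl⟩
    cases n with
    | zero => exact le_max_left _ _
    | succ n => exact max_le_max le_rfl (by linarith [hB ⟨n, rfl⟩])
  · rintro ⟨B, hB⟩
    refine ⟨B - h x, ?_⟩
    rintro _ ⟨n, rfl⟩
    have h1 : birkhoffMax T h (n + 1) x ≤ B := hB ⟨n + 1, rfl⟩
    have h2 : h x + birkhoffMax T h n (T x) ≤ birkhoffMax T h (n + 1) x := le_max_right _ _
    show birkhoffMax T h n (T x) ≤ B - h x
    linarith

variable [MeasurableSpace Ω] {P : Measure Ω}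

lemma measurable_birkhoffMax (hT : Measurable T) (hh : Measurable h) (n : ℕ) :
    Measurable (birkhoffMax T h n) := by
  induction n with
  | zero => exact measurable_const
  | succ n ih => exact measurable_const.max (hh.add (ih.comp hT))

lemma integrable_birkhoffMax (hT : MeasurePreserving T P P) (hi : Integrable h P) (n : ℕ) :
    Integrable (birkhoffMax T h n) P := by
  induction n with
  | zero => exact integrable_zero _ _ _
  | succ n ih => exact (integrable_zero _ _ _).sup (hi.add (hT.integrable_comp_of_integrable ih))

/-- If `h` has negative mean, then its Birkhoff sums along an ergodic map are almost surely
bounded above. -/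
lemma ae_bddAbove_birkhoffSum (hT : Ergodic T P) (hh : Measurable h) (hi : Integrable h P)
    (hneg : ∫ x, h x ∂P < 0) :
    ∀ᵐ x ∂P, BddAbove (range fun n => birkhoffSum T h n x) := by
  have hTp := hT.toMeasurePreserving
  let A : Set Ω := {x | BddAbove (range fun n => birkhoffMax T h n x)}
  have hA : MeasurableSet A :=
    measurableSet_bddAbove_range fun n => measurable_birkhoffMax hT.measurable hh n
  have hinv : T ⁻¹' A = A := by
    ext x
    exact bddAbove_birkhoffMax_comp x
  rcases hT.toPreErgodic.ae_mem_or_ae_notMem hA hinv with hall | hnone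
  · filter_upwards [hall] with x hx
    obtain ⟨B, hB⟩ := hx
    refine ⟨B, ?_⟩
    rintro _ ⟨n, rfl⟩
    exact (birkhoffSum_le_birkhoffMax n x).trans (hB ⟨n, rfl⟩)
  · exfalso
    have hcomp (n : ℕ) : Integrable (fun x => birkhoffMax T h n (T x)) P :=
      hTp.integrable_comp_of_integrable (integrable_birkhoffMax hTp hi n)
    have hlim : Tendsto (fun n => ∫ x, max (-birkhoffMax T h n (T x)) (h x) ∂P) atTop
        (nhds (∫ x, h x ∂P)) := by
      refine tendsto_integral_of_dominated_convergence (fun x => |h x|)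
        (fun n => ((hcomp n).neg.sup hi).aestronglyMeasurable) hi.abs (fun n => ?_) ?_
      · refine Eventually.of_forall fun x => ?_
        have := birkhoffMax_nonneg (T := T) (h := h) n (T x)
        rw [Real.norm_eq_abs]
        refine abs_le.2 ⟨(neg_abs_le _).trans (le_max_right _ _),
          max_le (by linarith [abs_nonneg (h x)]) (le_abs_self _)⟩
      · filter_upwards [hnone] with x hx
        have hx' : ¬ BddAbove (range fun n => birkhoffMax T h n (T x)) :=
          fun hb => hx ((bddAbove_birkhoffMax_comp x).1 hb)
        have htop := tendsto_atTop_atTop_of_monotone' (monotone_birkhoffMax (T x)) hx'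
        refine tendsto_const_nhds.congr' ?_
        filter_upwards [htop.eventually_ge_atTop (-h x)] with n hn
        exact (max_eq_right (by linarith)).symm
    refine absurd (ge_of_tendsto' hlim fun n => ?_) (not_le.2 hneg)
    calc (0 : ℝ) ≤ ∫ x, birkhoffMax T h (n + 1) x ∂P - ∫ x, birkhoffMax T h n x ∂P :=
          sub_nonneg.2 (integral_mono (integrable_birkhoffMax hTp hi n)
            (integrable_birkhoffMax hTp hi (n + 1)) fun x => birkhoffMax_le_succ n x)
      _ = ∫ x, birkhoffMax T h (n + 1) x ∂P - ∫ x, birkhoffMax T h n (T x) ∂P := by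
          congr 1
          conv_lhs => rw [← hTp.map_eq]
          exact integral_map hT.measurable.aemeasurable
            (measurable_birkhoffMax hT.measurable hh n).aestronglyMeasurable
      _ = ∫ x, max (-birkhoffMax T h n (T x)) (h x) ∂P := by
          rw [← integral_sub (integrable_birkhoffMax hTp hi (n + 1)) (hcomp n)]
          simp only [birkhoffMax_succ_sub]

lemma ae_eventually_birkhoff_le [IsProbabilityMeasure P] (hT : Ergodic T P)
    {g : Ω → ℝ} (hg : Measurable g) (hi : Integrable g P) {c : ℝ} (hc : 0 < c) :
    ∀ᵐ x ∂P, ∀ᶠ n : ℕ in atTop,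
      (n : ℝ)⁻¹ * ∑ i ∈ Finset.range n, g (T^[i] x) ≤ ∫ x, g x ∂P + c := by
  set m := ∫ x, g x ∂P
  have hneg : ∫ x, (g x - (m + c / 2)) ∂P < 0 := by
    rw [integral_sub hi (integrable_const _)]
    simp [m, hc]
  filter_upwards [ae_bddAbove_birkhoffSum hT (hg.sub_const _)
    (hi.sub (integrable_const _)) hneg] with x ⟨B, hB⟩
  have hlarge := (tendsto_natCast_atTop_atTop (R := ℝ)).eventually_ge_atTop (2 * B / c)
  filter_upwards [hlarge, eventually_gt_atTop 0] with n hn hn0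
  have hn0' : (0 : ℝ) < n := by exact_mod_cast hn0
  have h1 : birkhoffSum T (fun x => g x - (m + c / 2)) n x ≤ B := hB ⟨n, rfl⟩
  simp only [birkhoffSum, Finset.sum_sub_distrib, Finset.sum_const, Finset.card_range,
    nsmul_eq_mul] at h1
  rw [div_le_iff₀ hc] at hn
  rw [inv_mul_le_iff₀ hn0']
  nlinarith

/-- **Pointwise ergodic theorem**, in the `ε`-form for ergodic maps. -/
lemma ae_eventually_abs_birkhoff_sub_le [IsProbabilityMeasure P] (hT : Ergodic T P)
    {g : Ω → ℝ} (hg : Measurable g) (hi : Integrable g P) {c : ℝ} (hc : 0 < c) :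
    ∀ᵐ x ∂P, ∀ᶠ n : ℕ in atTop,
      |(n : ℝ)⁻¹ * ∑ i ∈ Finset.range n, g (T^[i] x) - ∫ x, g x ∂P| ≤ c := by
  filter_upwards [ae_eventually_birkhoff_le hT hg hi hc,
    ae_eventually_birkhoff_le hT hg.neg hi.neg hc] with x h1 h2
  filter_upwards [h1, h2] with n h1 h2
  simp only [Pi.neg_apply, Finset.sum_neg_distrib, integral_neg, mul_neg] at h2
  exact abs_le.2 ⟨by linarith, by linarith⟩

end Birkhoff

lemma FiniteVC.mono {X : Type*} {𝒞 𝒟 : Set (Set X)} (h : FiniteVC 𝒟) (hsub : 𝒞 ⊆ 𝒟) :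
    FiniteVC 𝒞 := by
  obtain ⟨k, hk⟩ := h
  refine ⟨k, fun D hD => hk D fun B hB => ?_⟩
  obtain ⟨C, hC, h⟩ := hD B hB
  exact ⟨C, hsub hC, h⟩

/-- A family of finite VC dimension does not contain arbitrarily many sets in general position. -/
lemma FiniteVC.exists_not_independent {X ι : Type*} {C : ι → Set X} (h : FiniteVC (range C)) :
    ∃ N : ℕ, ∀ s : Fin N → ι, ∃ b : Fin N → Bool, ∀ x, ¬ ∀ i, (x ∈ C (s i) ↔ b i = true) := by
  classical
  obtain ⟨k, hk⟩ := h
  let e := Fintype.equivFin (Finset (Fin (k + 1)))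
  refine ⟨Fintype.card (Finset (Fin (k + 1))), fun s => ?_⟩
  by_contra! hs
  choose x hx using fun j : Fin (k + 1) => hs fun i => decide (j ∈ e.symm i)
  have hx' (j : Fin (k + 1)) (S : Finset (Fin (k + 1))) : x j ∈ C (s (e S)) ↔ j ∈ S := by
    simpa using hx j (e S)
  have hinj : Function.Injective x := by
    intro i j hij
    have := (hx' i {j}).1 (hij ▸ (hx' j {j}).2 (Finset.mem_singleton_self j))
    exact Finset.mem_singleton.1 this
  have hcard := hk (Finset.univ.image x) fun B _ => by
    refine ⟨_, ⟨s (e {j | x j ∈ B}), rfl⟩, fun y hy => ?_⟩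
    obtain ⟨j, -, rfl⟩ := Finset.mem_image.1 hy
    simp [hx']
  rw [Finset.card_image_of_injective _ hinj] at hcard
  simp at hcard

/-- The pointwise supremum of the functions `g n`, `n ∈ D`. -/
noncomputable def supOn {X : Type*} (g : ℕ → X → ℝ) (D : Set ℕ) (x : X) : ℝ := ⨆ n : D, g n x

section SupOn

variable {X : Type*} {g : ℕ → X → ℝ} {F : X → ℝ} {D E : Set ℕ}

lemma bddAbove_range_of_abs_le (hgF : ∀ n x, |g n x| ≤ F x) (D : Set ℕ) (x : X) :
    BddAbove (range fun n : D => g n x) := by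
  refine ⟨F x, ?_⟩
  rintro _ ⟨n, rfl⟩
  exact (le_abs_self _).trans (hgF n x)

lemma le_supOn (hgF : ∀ n x, |g n x| ≤ F x) {n : ℕ} (hn : n ∈ D) (x : X) : g n x ≤ supOn g D x :=
  le_ciSup (bddAbove_range_of_abs_le hgF D x) ⟨n, hn⟩

lemma supOn_le (hD : D.Nonempty) {x : X} {a : ℝ} (h : ∀ n ∈ D, g n x ≤ a) : supOn g D x ≤ a :=
  have := hD.to_subtype
  ciSup_le fun n => h n n.2

lemma supOn_mono (hgF : ∀ n x, |g n x| ≤ F x) (hD : D.Nonempty) (hDE : D ⊆ E) (x : X) :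
    supOn g D x ≤ supOn g E x :=
  supOn_le hD fun _ hn => le_supOn hgF (hDE hn) x

lemma abs_supOn_le (hgF : ∀ n x, |g n x| ≤ F x) (D : Set ℕ) (x : X) : |supOn g D x| ≤ F x := by
  rcases D.eq_empty_or_nonempty with rfl | ⟨n, hn⟩
  · simpa [supOn] using (abs_nonneg _).trans (hgF 0 x)
  · exact abs_le.2 ⟨(abs_le.1 (hgF n x)).1.trans (le_supOn hgF hn x),
      supOn_le ⟨n, hn⟩ fun m _ => (abs_le.1 (hgF m x)).2⟩

lemma bddBelow_range_supOn (hgF : ∀ n x, |g n x| ≤ F x) (E : ℕ → Set ℕ) (x : X) :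
    BddBelow (range fun k => supOn g (E k) x) := by
  refine ⟨-F x, ?_⟩
  rintro _ ⟨n, rfl⟩
  exact (abs_le.1 (abs_supOn_le hgF _ x)).1

lemma abs_iInf_supOn_le (hgF : ∀ n x, |g n x| ≤ F x) (E : ℕ → Set ℕ) (x : X) :
    |⨅ k, supOn g (E k) x| ≤ F x :=
  abs_le.2 ⟨le_ciInf fun k => (abs_le.1 (abs_supOn_le hgF (E k) x)).1,
    (ciInf_le (bddBelow_range_supOn hgF E x) 0).trans (abs_le.1 (abs_supOn_le hgF (E 0) x)).2⟩

variable [MeasurableSpace X] {μ : Measure X}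

lemma measurable_supOn (hg : ∀ n, Measurable (g n)) (D : Set ℕ) : Measurable (supOn g D) :=
  .iSup fun n : D => hg n

lemma integrable_supOn (hg : ∀ n, Measurable (g n)) (hgF : ∀ n x, |g n x| ≤ F x)
    (hF : Integrable F μ) (D : Set ℕ) : Integrable (supOn g D) μ :=
  hF.mono' (measurable_supOn hg D).aestronglyMeasurable
    (Eventually.of_forall fun x => abs_supOn_le hgF D x)

lemma measurable_iInf_supOn (hg : ∀ n, Measurable (g n)) (E : ℕ → Set ℕ) :
    Measurable fun x => ⨅ k, supOn g (E k) x :=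
  .iInf fun k => measurable_supOn hg (E k)

lemma integrable_iInf_supOn (hg : ∀ n, Measurable (g n)) (hgF : ∀ n x, |g n x| ≤ F x)
    (hF : Integrable F μ) (E : ℕ → Set ℕ) : Integrable (fun x => ⨅ k, supOn g (E k) x) μ :=
  hF.mono' (measurable_iInf_supOn hg E).aestronglyMeasurable
    (Eventually.of_forall fun x => abs_iInf_supOn_le hgF E x)

lemma tendsto_integral_supOn (hg : ∀ n, Measurable (g n)) (hgF : ∀ n x, |g n x| ≤ F x)
    (hF : Integrable F μ) {E : ℕ → Set ℕ} (hE : Antitone E) (hne : ∀ k, (E k).Nonempty) :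
    Tendsto (fun k => ∫ x, supOn g (E k) x ∂μ) atTop (nhds (∫ x, ⨅ k, supOn g (E k) x ∂μ)) :=
  tendsto_integral_of_dominated_convergence F
    (fun k => (measurable_supOn hg (E k)).aestronglyMeasurable) hF
    (fun k => Eventually.of_forall fun x => abs_supOn_le hgF (E k) x)
    (Eventually.of_forall fun x => tendsto_atTop_ciInf
      (fun _ j hij => supOn_mono hgF (hne j) (hE hij) x) (bddBelow_range_supOn hgF E x))

/-- The essential infimum `u` of the suprema `supOn g D` over the members `D` of a filter: it is
an a.e. lower bound, and its integral is the infimum of the integrals. -/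
lemma exists_essInf_supOn (hg : ∀ n, Measurable (g n)) (hgF : ∀ n x, |g n x| ≤ F x)
    (hF : Integrable F μ) (U : Filter ℕ) [U.NeBot] :
    ∃ u : X → ℝ, Integrable u μ ∧ (∀ D ∈ U, u ≤ᵐ[μ] supOn g D) ∧
      ∀ δ > 0, ∃ D ∈ U, ∫ x, supOn g D x ∂μ ≤ ∫ x, u x ∂μ + δ := by
  let V : Set ℕ → ℝ := fun D => ∫ x, supOn g D x ∂μ
  let m : ℝ := sInf (V '' U.sets)
  have hne : (V '' U.sets).Nonempty := ⟨V univ, univ, univ_mem, rfl⟩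
  have hbdd : BddBelow (V '' U.sets) := by
    refine ⟨-∫ x, F x ∂μ, ?_⟩
    rintro _ ⟨D, -, rfl⟩
    rw [← integral_neg]
    exact integral_mono hF.neg (integrable_supOn hg hgF hF D)
      fun x => (abs_le.1 (abs_supOn_le hgF D x)).1
  have hm (D : Set ℕ) (hD : D ∈ U) : m ≤ V D := csInf_le hbdd ⟨D, hD, rfl⟩
  have hseq (n : ℕ) : ∃ D ∈ U, V D < m + 1 / ((n : ℝ) + 1) := by
    obtain ⟨_, ⟨D, hD, rfl⟩, hlt⟩ :=
      exists_lt_of_csInf_lt hne (lt_add_of_pos_right m (Nat.one_div_pos_of_nat (n := n) (α := ℝ)))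
    exact ⟨D, hD, hlt⟩
  choose D hDU hDm using hseq
  let E : ℕ → Set ℕ := fun n => ⋂ i ∈ Finset.range (n + 1), D i
  have hEU (n : ℕ) : E n ∈ U := (biInter_finset_mem _).2 fun i _ => hDU i
  have hE : Antitone E := fun i j hij =>
    biInter_subset_biInter_left fun a ha => by simp at ha ⊢; omega
  have hED (n : ℕ) : E n ⊆ D n := biInter_subset_of_mem (by simp)
  have hlim := tendsto_integral_supOn hg hgF hF hE fun k => U.nonempty_of_mem (hEU k)
  have hle : ∫ x, ⨅ k, supOn g (E k) x ∂μ ≤ m := by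
    refine le_of_tendsto_of_tendsto' hlim
      (by simpa using tendsto_const_nhds.add (tendsto_one_div_add_atTop_nhds_zero_nat (𝕜 := ℝ)))
      fun n => ?_
    rw [← one_div]
    refine le_trans ?_ (hDm n).le
    exact integral_mono (integrable_supOn hg hgF hF _) (integrable_supOn hg hgF hF _)
      (supOn_mono hgF (U.nonempty_of_mem (hEU n)) (hED n))
  refine ⟨fun x => ⨅ k, supOn g (E k) x, integrable_iInf_supOn hg hgF hF E, fun S hS => ?_, fun δ hδ => ?_⟩
  · let E' : ℕ → Set ℕ := fun n => E n ∩ S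
    have hEU' (n : ℕ) : E' n ∈ U := inter_mem (hEU n) hS
    have hE' : Antitone E' := fun i j hij => inter_subset_inter_left _ (hE hij)
    have hge : m ≤ ∫ x, ⨅ k, supOn g (E' k) x ∂μ :=
      ge_of_tendsto' (tendsto_integral_supOn hg hgF hF hE' fun k => U.nonempty_of_mem (hEU' k))
        fun n => hm _ (hEU' n)
    have hmono (x : X) : ⨅ k, supOn g (E' k) x ≤ ⨅ k, supOn g (E k) x :=
      ciInf_mono (bddBelow_range_supOn hgF E' x) fun k =>
        supOn_mono hgF (U.nonempty_of_mem (hEU' k)) inter_subset_left x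
    have hi := integrable_iInf_supOn hg hgF hF E
    have hi' := integrable_iInf_supOn hg hgF hF E'
    have heq := (integral_eq_iff_of_ae_le hi' hi (Eventually.of_forall hmono)).1
      (le_antisymm (integral_mono hi' hi hmono) (hle.trans hge))
    filter_upwards [heq] with x hx
    rw [← hx]
    exact (ciInf_le (bddBelow_range_supOn hgF E' x) 0).trans
      (supOn_mono hgF (U.nonempty_of_mem (hEU' 0)) inter_subset_right x)
  · obtain ⟨n, hn⟩ := (hlim.eventually (ge_mem_nhds (lt_add_of_pos_right _ hδ))).exists
    exact ⟨E n, hEU n, hn⟩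

/-- A set of positive measure on which the essential infimum of the suprema along an ultrafilter
exceeds `α` meets `{x | α < g n x}` in positive measure for most `n`. -/
lemma eventually_measure_inter_pos
    {U : Ultrafilter ℕ} {u : X → ℝ} (hu : ∀ D ∈ U, u ≤ᵐ[μ] supOn g D) {α : ℝ} {A : Set X}
    (hAu : ∀ x ∈ A, α < u x) (hA : 0 < μ A) :
    ∀ᶠ n in (U : Filter ℕ), 0 < μ (A ∩ {x | α < g n x}) := by
  by_contra hcon
  have hD : {n | μ (A ∩ {x | α < g n x}) = 0} ∈ U := by
    have := Ultrafilter.eventually_not.2 hcon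
    filter_upwards [this] with n hn
    simpa using hn
  set D := {n | μ (A ∩ {x | α < g n x}) = 0}
  have hae : ∀ᵐ x ∂μ, ∀ n ∈ D, x ∉ A ∩ {x | α < g n x} :=
    (ae_ball_iff D.to_countable).2 fun n hn => measure_eq_zero_iff_ae_notMem.1 hn
  refine hA.ne' (measure_eq_zero_iff_ae_notMem.2 ?_)
  filter_upwards [hae, hu D hD] with x hx hxu hxA
  have : supOn g D x ≤ α := supOn_le (U.nonempty_of_mem hD) fun n hn => by
    by_contra! hlt
    exact hx n hn ⟨hxA, hlt⟩
  linarith [hAu x hxA]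

/-- If the essential limits of `g` along an ultrafilter from above and below are separated by `α`
on a set of positive measure, then there are arbitrarily many level sets `{x | g n x ≤ α}` in
general position. -/
lemma exists_independent_levels
    {U : Ultrafilter ℕ} {u v : X → ℝ} (hu : ∀ D ∈ U, u ≤ᵐ[μ] supOn g D)
    (hv : ∀ D ∈ U, v ≤ᵐ[μ] supOn (fun n x => -g n x) D) {α : ℝ}
    (hpos : 0 < μ {x | -v x < α ∧ α < u x}) (N : ℕ) :
    ∃ s : Fin N → ℕ, ∀ b : Fin N → Bool,
      0 < μ {x | (-v x < α ∧ α < u x) ∧ ∀ i, (g (s i) x ≤ α ↔ b i = true)} := by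
  induction N with
  | zero => exact ⟨Fin.elim0, fun b => by simpa using hpos⟩
  | succ N ih =>
    obtain ⟨s, hs⟩ := ih
    have hgt : ∀ᶠ n in (U : Filter ℕ), ∀ b : Fin N → Bool, 0 < μ
        ({x | (-v x < α ∧ α < u x) ∧ ∀ i, (g (s i) x ≤ α ↔ b i = true)} ∩ {x | α < g n x}) :=
      eventually_all.2 fun b => eventually_measure_inter_pos hu (fun x hx => hx.1.2) (hs b)
    have hlt : ∀ᶠ n in (U : Filter ℕ), ∀ b : Fin N → Bool, 0 < μ
        ({x | (-v x < α ∧ α < u x) ∧ ∀ i, (g (s i) x ≤ α ↔ b i = true)} ∩ {x | -α < -g n x}) :=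
      eventually_all.2 fun b => eventually_measure_inter_pos hv (fun x hx => by linarith [hx.1.1]) (hs b)
    obtain ⟨n, hn1, hn2⟩ := (hgt.and hlt).exists
    refine ⟨Fin.cons n s, fun b => ?_⟩
    cases hb : b 0 with
    | false =>
      refine (hn1 (Fin.tail b)).trans_le (measure_mono ?_)
      rintro x ⟨⟨hx1, hx2⟩, hx3⟩
      refine ⟨hx1, Fin.forall_fin_succ.2 ⟨?_, hx2⟩⟩
      simpa [hb] using hx3
    | true =>
      refine (hn2 (Fin.tail b)).trans_le (measure_mono ?_)
      rintro x ⟨⟨hx1, hx2⟩, hx3⟩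
      refine ⟨hx1, Fin.forall_fin_succ.2 ⟨?_, hx2⟩⟩
      simpa [hb] using (neg_lt_neg_iff.1 hx3).le

/-- **Finite bracketing**: a countable VC major family with an integrable envelope splits into
finitely many subfamilies, each of small oscillation in mean. -/
lemma exists_finite_bracketing (hg : ∀ n, Measurable (g n)) (hgF : ∀ n x, |g n x| ≤ F x)
    (hF : Integrable F μ) (hVC : ∀ α : ℝ, FiniteVC (range fun n => {x | g n x ≤ α}))
    {ε : ℝ} (hε : 0 < ε) :
    ∃ 𝒯 : Set (Set ℕ), 𝒯.Finite ∧ ⋃₀ 𝒯 = univ ∧ ∀ D ∈ 𝒯,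
      ∫ x, supOn g D x ∂μ + ∫ x, supOn (fun n x => -g n x) D x ∂μ ≤ ε := by
  let osc : Set ℕ → ℝ := fun D =>
    ∫ x, supOn g D x ∂μ + ∫ x, supOn (fun n x => -g n x) D x ∂μ
  let good : Set ℕ → Prop := fun S => ∃ 𝒯 : Set (Set ℕ), 𝒯.Finite ∧ S ⊆ ⋃₀ 𝒯 ∧ ∀ D ∈ 𝒯, osc D ≤ ε
  have hgood_of_osc (D : Set ℕ) (hD : osc D ≤ ε) : good D :=
    ⟨{D}, finite_singleton D, by simp, by simpa using hD⟩
  by_contra hcon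
  have hbad : ¬ good univ := fun ⟨𝒯, h1, h2, h3⟩ => hcon ⟨𝒯, h1, univ_subset_iff.1 h2, h3⟩
  let ℓ : Filter ℕ := Filter.comk good ⟨∅, finite_empty, by simp, by simp⟩
    (fun t ⟨𝒯, h1, h2, h3⟩ s hst => ⟨𝒯, h1, hst.trans h2, h3⟩)
    (fun s ⟨𝒯, h1, h2, h3⟩ t ⟨𝒯', h1', h2', h3'⟩ => ⟨𝒯 ∪ 𝒯', h1.union h1', by
      rw [sUnion_union]
      exact union_subset_union h2 h2', by
      rintro D (hD | hD)
      exacts [h3 D hD, h3' D hD]⟩)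
  have : ℓ.NeBot := by
    refine neBot_iff.2 fun h => hbad ?_
    have : (∅ : Set ℕ) ∈ ℓ := h ▸ mem_bot
    simpa [ℓ] using this
  let U := Ultrafilter.of ℓ
  have hU (D : Set ℕ) (hD : D ∈ U) : ε < osc D := by
    by_contra! hle
    have hc : Dᶜ ∈ ℓ := by simpa [ℓ] using hgood_of_osc D hle
    exact Ultrafilter.compl_notMem_iff.2 hD (Ultrafilter.of_le ℓ hc)
  have hgn (n : ℕ) : Measurable fun x => -g n x := (hg n).neg
  have hgFn (n : ℕ) (x : X) : |-g n x| ≤ F x := by simpa using hgF n x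
  obtain ⟨u, hui, hu, huV⟩ := exists_essInf_supOn hg hgF hF (U : Filter ℕ)
  obtain ⟨v, hvi, hv, hvV⟩ := exists_essInf_supOn hgn hgFn hF (U : Filter ℕ)
  have hint : 0 < ∫ x, u x ∂μ + ∫ x, v x ∂μ := by
    obtain ⟨D, hD, hDu⟩ := huV (ε / 2) (by positivity)
    obtain ⟨D', hD', hDv⟩ := hvV (ε / 2) (by positivity)
    have hne := U.nonempty_of_mem (inter_mem hD hD')
    have h1 := hU _ (inter_mem hD hD')
    have h2 : ∫ x, supOn g (D ∩ D') x ∂μ ≤ ∫ x, supOn g D x ∂μ :=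
      integral_mono (integrable_supOn hg hgF hF _) (integrable_supOn hg hgF hF _)
        (supOn_mono hgF hne inter_subset_left)
    have h3 : ∫ x, supOn (fun n x => -g n x) (D ∩ D') x ∂μ
        ≤ ∫ x, supOn (fun n x => -g n x) D' x ∂μ :=
      integral_mono (integrable_supOn hgn hgFn hF _) (integrable_supOn hgn hgFn hF _)
        (supOn_mono hgFn hne inter_subset_right)
    simp only [osc] at h1
    linarith
  obtain ⟨q, hq⟩ : ∃ q : ℚ, 0 < μ {x | -v x < q ∧ q < u x} := by
    by_contra! hnull
    have hae : ∀ᵐ x ∂μ, ∀ q : ℚ, ¬ (-v x < q ∧ q < u x) :=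
      ae_all_iff.2 fun q => measure_eq_zero_iff_ae_notMem.1 (le_zero_iff.1 (hnull q))
    rw [← integral_add hui hvi] at hint
    refine hint.not_ge (integral_nonpos_of_ae ?_)
    filter_upwards [hae] with x hx
    by_contra! hlt
    obtain ⟨q, hq1, hq2⟩ := exists_rat_btwn (show -v x < u x by simp at hlt; linarith)
    exact hx q ⟨hq1, hq2⟩
  obtain ⟨N, hN⟩ := (hVC q).exists_not_independent
  obtain ⟨s, hs⟩ := exists_independent_levels hu hv hq N
  obtain ⟨b, hb⟩ := hN s
  obtain ⟨x, hx⟩ := nonempty_of_measure_ne_zero (hs b).ne'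
  exact hb x hx.2

end SupOn

/-- Uniform ergodic theorem for a VC major sequence with an integrable envelope. -/
lemma ae_eventually_forall_abs_birkhoff_sub_le {X Ω : Type*} [MeasurableSpace X]
    [MeasurableSpace Ω] {g : ℕ → X → ℝ} {F : X → ℝ} {P : Measure Ω} [IsProbabilityMeasure P]
    {T : Ω → Ω} (hT : Ergodic T P) {Y : Ω → X} (hY : Measurable Y)
    (hg : ∀ n, Measurable (g n)) (hgF : ∀ n x, |g n x| ≤ F x) (hF : Integrable F (P.map Y))
    (hVC : ∀ α : ℝ, FiniteVC (range fun n => {x | g n x ≤ α})) {ε : ℝ} (hε : 0 < ε) :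
    ∀ᵐ ω ∂P, ∀ᶠ n : ℕ in atTop, ∀ m, |(n : ℝ)⁻¹ * ∑ i ∈ Finset.range n, g m (Y (T^[i] ω))
      - ∫ x, g m x ∂P.map Y| ≤ ε := by
  obtain ⟨𝒯, hfin, hcover, hosc⟩ := exists_finite_bracketing hg hgF hF hVC (half_pos hε)
  have hgn (n : ℕ) : Measurable fun x => -g n x := (hg n).neg
  have hgFn (n : ℕ) (x : X) : |-g n x| ≤ F x := by simpa using hgF n x
  have herg (f : X → ℝ) (hf : Measurable f) (hfi : Integrable f (P.map Y)) :
      ∀ᵐ ω ∂P, ∀ᶠ n : ℕ in atTop, |(n : ℝ)⁻¹ * ∑ i ∈ Finset.range n, f (Y (T^[i] ω))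
        - ∫ x, f x ∂P.map Y| ≤ ε / 2 := by
    rw [integral_map hY.aemeasurable hf.aestronglyMeasurable]
    exact ae_eventually_abs_birkhoff_sub_le hT (hf.comp hY) (hfi.comp_measurable hY) (half_pos hε)
  have h1 := (ae_ball_iff hfin.countable).2 fun D (_ : D ∈ 𝒯) =>
    herg _ (measurable_supOn hg D) (integrable_supOn hg hgF hF D)
  have h2 := (ae_ball_iff hfin.countable).2 fun D (_ : D ∈ 𝒯) =>
    herg _ (measurable_supOn hgn D) (integrable_supOn hgn hgFn hF D)
  filter_upwards [h1, h2] with ω h1 h2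
  filter_upwards [(eventually_all_finite hfin).2 h1, (eventually_all_finite hfin).2 h2]
    with n h1 h2 m
  obtain ⟨D, hD, hm⟩ : m ∈ ⋃₀ 𝒯 := hcover ▸ mem_univ m
  have hgi : Integrable (g m) (P.map Y) :=
    hF.mono' (hg m).aestronglyMeasurable (Eventually.of_forall fun x => hgF m x)
  have hu : (n : ℝ)⁻¹ * ∑ i ∈ Finset.range n, g m (Y (T^[i] ω))
      ≤ (n : ℝ)⁻¹ * ∑ i ∈ Finset.range n, supOn g D (Y (T^[i] ω)) := by
    gcongr
    exact le_supOn hgF hm _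
  have hl : (n : ℝ)⁻¹ * ∑ i ∈ Finset.range n, -g m (Y (T^[i] ω))
      ≤ (n : ℝ)⁻¹ * ∑ i ∈ Finset.range n, supOn (fun n x => -g n x) D (Y (T^[i] ω)) := by
    gcongr
    exact le_supOn hgFn hm _
  have hui : ∫ x, g m x ∂P.map Y ≤ ∫ x, supOn g D x ∂P.map Y :=
    integral_mono hgi (integrable_supOn hg hgF hF D) (le_supOn hgF hm)
  have hli : ∫ x, -g m x ∂P.map Y ≤ ∫ x, supOn (fun n x => -g n x) D x ∂P.map Y :=
    integral_mono hgi.neg (integrable_supOn hgn hgFn hF D) (le_supOn hgFn hm)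
  rw [integral_neg] at hli
  rw [Finset.sum_neg_distrib, mul_neg] at hl
  have hu' := abs_le.1 (h1 D hD)
  have hl' := abs_le.1 (h2 D hD)
  have := hosc D hD
  exact abs_le.2 ⟨by linarith, by linarith⟩

/-- **Ergodic ULLN for VC major families.** If every level-set family
`𝒞_α = {{x | f x ≤ α} : f ∈ ℱ}` of the separable family `ℱ` has finite VC dimension and
the envelope `F` is integrable under the marginal `μ` of a stationary ergodic process,
then the empirical means converge uniformly over `ℱ`, almost surely. -/
theorem ergodic_ulln_vc_major {X : Type*} [MeasurableSpace X]
    (ℱ : Set (X → ℝ)) (hmeas : ∀ f ∈ ℱ, Measurable f) (hsep : SeparableFamily ℱ)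
    (F : X → ℝ) (hF : Measurable F) (hF0 : ∀ x, 0 ≤ F x)
    (henv : ∀ f ∈ ℱ, ∀ x, |f x| ≤ F x)
    (hlevel : ∀ α : ℝ, FiniteVC ((fun f => {x | f x ≤ α}) '' ℱ))
    {Ω : Type*} [MeasurableSpace Ω] (ℙ : Measure Ω) [IsProbabilityMeasure ℙ]
    (T : Ω → Ω) (hT : Ergodic T ℙ) (X₁ : Ω → X) (hX₁ : Measurable X₁)
    (μ : Measure X) (hμ : Measure.map X₁ ℙ = μ) (hFint : Integrable F μ) :
    ∀ᵐ ω ∂ℙ, Filter.Tendsto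
      (fun n : ℕ => ⨆ f : ℱ, |(n : ℝ)⁻¹ * ∑ i ∈ Finset.range n,
          (f : X → ℝ) (X₁ (T^[i] ω)) - ∫ x, (f : X → ℝ) x ∂μ|)
      Filter.atTop (nhds 0) := by
  subst hμ
  obtain ⟨ℱ₀, hsub, hcount, hdense⟩ := hsep
  rcases ℱ₀.eq_empty_or_nonempty with rfl | hne
  · have : IsEmpty ℱ := ⟨fun ⟨f, hf⟩ => by
      obtain ⟨g, hg, -⟩ := hdense f hf
      exact hg 0⟩
    simp
  obtain ⟨g, rfl⟩ := hcount.exists_eq_range hne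
  have hgℱ (n : ℕ) : g n ∈ ℱ := hsub ⟨n, rfl⟩
  have hVC (α : ℝ) : FiniteVC (range fun n => {x | g n x ≤ α}) := by
    refine (hlevel α).mono ?_
    rintro _ ⟨n, rfl⟩
    exact ⟨g n, hgℱ n, rfl⟩
  have hae : ∀ᵐ ω ∂ℙ, ∀ k : ℕ, ∀ᶠ n : ℕ in atTop, ∀ m,
      |(n : ℝ)⁻¹ * ∑ i ∈ Finset.range n, g m (X₁ (T^[i] ω)) - ∫ x, g m x ∂ℙ.map X₁|
        ≤ 1 / ((k : ℝ) + 1) :=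
    ae_all_iff.2 fun k => ae_eventually_forall_abs_birkhoff_sub_le hT hX₁
      (fun n => hmeas _ (hgℱ n)) (fun n => henv _ (hgℱ n)) hFint hVC Nat.one_div_pos_of_nat
  filter_upwards [hae] with ω hω
  rw [Metric.tendsto_atTop']
  intro ε hε
  obtain ⟨k, hk⟩ := exists_nat_one_div_lt hε
  obtain ⟨N, hN⟩ := eventually_atTop.1 (hω k)
  refine ⟨N, fun n hn => ?_⟩
  rw [Real.dist_0_eq_abs, abs_of_nonneg (Real.iSup_nonneg fun _ => abs_nonneg _)]
  refine (Real.iSup_le (fun f => ?_) Nat.one_div_pos_of_nat.le).trans_lt hk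
  obtain ⟨φ, hφ, hlim⟩ := hdense f f.2
  have hint : Tendsto (fun j => ∫ x, φ j x ∂ℙ.map X₁) atTop
      (nhds (∫ x, (f : X → ℝ) x ∂ℙ.map X₁)) :=
    tendsto_integral_of_dominated_convergence F
      (fun j => (hmeas _ (hsub (hφ j))).aestronglyMeasurable) hFint
      (fun j => Eventually.of_forall fun x => henv _ (hsub (hφ j)) x) (Eventually.of_forall hlim)
  have hsum := (tendsto_finsetSum (Finset.range n)
    fun i _ => hlim (X₁ (T^[i] ω))).const_mul (n : ℝ)⁻¹
  refine le_of_tendsto' (hsum.sub hint).abs fun j => ?_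
  obtain ⟨m, hm⟩ := hφ j
  exact hm ▸ hN n hn.le m
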